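/- Let ε > 0, T > 0, and let u, B : ℝ³ × [0,T] → ℝ³ and φ : ℝ³ × [0,T] → ℝ be three times continuously differentiable. Suppose that for all (x, τ) ∈ ℝ³ × [0,T] the rescaled induction equation ∂_τ B + √ε ∇φ = √ε Δ B − √ε curl(u × B) and the rescaled constraint equation √ε ∂_τ φ + div B = 0 hold pointwise. Then φ satisfies the inhomogeneous wave equation ∂_{ττ} φ − Δ φ = −Δ(div B) pointwise on ℝ³ × (0,T), where all spatial differential operators (∇, div, curl, Δ) act in the x variable. -/

import Mathlib

/-- `∂_j g` at `x`: the `j`-th spatial partial derivative of a scalar function. -/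
noncomputable def pd3 (g : (Fin 3 → ℝ) → ℝ) (x : Fin 3 → ℝ) (j : Fin 3) : ℝ :=
  fderiv ℝ g x (Pi.single j 1)

/-- The spatial Laplacian of a scalar function on `ℝ³` at `x`. -/
noncomputable def lap3 (g : (Fin 3 → ℝ) → ℝ) (x : Fin 3 → ℝ) : ℝ :=
  ∑ j, pd3 (fun y => pd3 g y j) x j

/-- The divergence of a vector field on `ℝ³` at `x`. -/
noncomputable def div3 (F : (Fin 3 → ℝ) → (Fin 3 → ℝ)) (x : Fin 3 → ℝ) : ℝ :=
  ∑ j, pd3 (fun y => F y j) x j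

/-- The curl of a vector field on `ℝ³` at `x` (with `0`-based indices). -/
noncomputable def curl3 (F : (Fin 3 → ℝ) → (Fin 3 → ℝ)) (x : Fin 3 → ℝ) : Fin 3 → ℝ :=
  ![pd3 (fun y => F y 2) x 1 - pd3 (fun y => F y 1) x 2,
    pd3 (fun y => F y 0) x 2 - pd3 (fun y => F y 2) x 0,
    pd3 (fun y => F y 1) x 0 - pd3 (fun y => F y 0) x 1]

section DirectionalDerivative

variable {E : Type*} [NormedAddCommGroup E] [NormedSpace ℝ E]

/-- The derivative of `f` in the constant direction `v`, as a function of the base point. -/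
noncomputable def dirDeriv (v : E) (f : E → ℝ) (p : E) : ℝ :=
  fderiv ℝ f p v

theorem ContDiff.dirDeriv {m n : WithTop ℕ∞} {f : E → ℝ} (hf : ContDiff ℝ n f) (v : E)
    (hmn : m + 1 ≤ n) : ContDiff ℝ m (dirDeriv v f) :=
  (hf.fderiv_right hmn).clm_apply contDiff_const

theorem dirDeriv_add {f g : E → ℝ} {p : E} (v : E) (hf : DifferentiableAt ℝ f p)
    (hg : DifferentiableAt ℝ g p) :
    dirDeriv v (fun q => f q + g q) p = dirDeriv v f p + dirDeriv v g p := by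
  simp [dirDeriv, fderiv_fun_add hf hg]

theorem dirDeriv_sub {f g : E → ℝ} {p : E} (v : E) (hf : DifferentiableAt ℝ f p)
    (hg : DifferentiableAt ℝ g p) :
    dirDeriv v (fun q => f q - g q) p = dirDeriv v f p - dirDeriv v g p := by
  simp [dirDeriv, fderiv_fun_sub hf hg]

theorem dirDeriv_const_mul {f : E → ℝ} {p : E} (v : E) (c : ℝ) (hf : DifferentiableAt ℝ f p) :
    dirDeriv v (fun q => c * f q) p = c * dirDeriv v f p := by
  simp [dirDeriv, fderiv_const_mul hf]

theorem dirDeriv_sum {ι : Type*} [Fintype ι] {f : ι → E → ℝ} {p : E} (v : E)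
    (hf : ∀ i, DifferentiableAt ℝ (f i) p) :
    dirDeriv v (fun q => ∑ i, f i q) p = ∑ i, dirDeriv v (f i) p := by
  simp [dirDeriv, fderiv_fun_sum (fun i _ => hf i)]

theorem dirDeriv_comm {f : E → ℝ} (hf : ContDiff ℝ 2 f) (v w : E) (p : E) :
    dirDeriv v (dirDeriv w f) p = dirDeriv w (dirDeriv v f) p := by
  have hd : DifferentiableAt ℝ (fderiv ℝ f) p :=
    ((hf.fderiv_right (m := 1) (by norm_num)).differentiable (by norm_num)) p
  have key : ∀ a b : E, dirDeriv a (dirDeriv b f) p = fderiv ℝ (fderiv ℝ f) p a b := by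
    intro a b
    change fderiv ℝ (fun q => fderiv ℝ f q b) p a = _
    rw [fderiv_clm_apply hd (differentiableAt_const b)]
    simp
  rw [key, key]
  exact (hf.contDiffAt.isSymmSndFDerivAt (by simp)) v w

theorem Filter.EventuallyEq.dirDeriv_eq {f g : E → ℝ} {p : E} (h : f =ᶠ[nhds p] g) (v : E) :
    dirDeriv v f p = dirDeriv v g p := by
  simp [dirDeriv, h.fderiv_eq]

/-- The curl of the triple `w` with respect to the constant directions `e`. -/
noncomputable def dirCurl (e : Fin 3 → E) (w : Fin 3 → E → ℝ) : Fin 3 → E → ℝ :=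
  ![fun q => dirDeriv (e 1) (w 2) q - dirDeriv (e 2) (w 1) q,
    fun q => dirDeriv (e 2) (w 0) q - dirDeriv (e 0) (w 2) q,
    fun q => dirDeriv (e 0) (w 1) q - dirDeriv (e 1) (w 0) q]

theorem differentiable_dirCurl {w : Fin 3 → E → ℝ} (hw : ∀ i, ContDiff ℝ 2 (w i))
    (e : Fin 3 → E) (i : Fin 3) : Differentiable ℝ (dirCurl e w i) := by
  have hd : ∀ i j, Differentiable ℝ (dirDeriv (e i) (w j)) := fun i j =>
    ((hw j).dirDeriv (m := 1) (e i) (by norm_num)).differentiable (by norm_num)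
  fin_cases i <;> exact (hd _ _).sub (hd _ _)

/-- The divergence of a curl vanishes, in arbitrary constant directions. -/
theorem dirDeriv_div_curl {w : Fin 3 → E → ℝ} (hw : ∀ i, ContDiff ℝ 2 (w i)) (e : Fin 3 → E)
    (p : E) :
    ∑ i, dirDeriv (e i) (dirCurl e w i) p = 0 := by
  have hd : ∀ i j, DifferentiableAt ℝ (dirDeriv (e i) (w j)) p := fun i j =>
    ((hw j).dirDeriv (m := 1) (e i) (by norm_num)).differentiable (by norm_num) p
  simp only [dirCurl, Fin.sum_univ_three, Matrix.cons_val]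
  rw [dirDeriv_sub _ (hd 1 2) (hd 2 1), dirDeriv_sub _ (hd 2 0) (hd 0 2),
    dirDeriv_sub _ (hd 0 1) (hd 1 0), dirDeriv_comm (hw 2) (e 0), dirDeriv_comm (hw 1) (e 0),
    dirDeriv_comm (hw 0) (e 1)]
  ring

theorem dirDeriv_div_laplacian {b : Fin 3 → E → ℝ} (hb : ∀ i, ContDiff ℝ 3 (b i))
    (e : Fin 3 → E) (p : E) :
    ∑ i, dirDeriv (e i) (fun q => ∑ j, dirDeriv (e j) (dirDeriv (e j) (b i)) q) p =
      ∑ j, dirDeriv (e j) (dirDeriv (e j) (fun q => ∑ i, dirDeriv (e i) (b i) q)) p := by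
  have h₂ : ∀ i v, ContDiff ℝ 2 (dirDeriv v (b i)) := fun i v =>
    (hb i).dirDeriv v (by norm_num)
  have h₁ : ∀ i v w, Differentiable ℝ (dirDeriv v (dirDeriv w (b i))) := fun i v w =>
    ((h₂ i w).dirDeriv (m := 1) v (by norm_num)).differentiable (by norm_num)
  have hl : ∀ i, dirDeriv (e i) (fun q => ∑ j, dirDeriv (e j) (dirDeriv (e j) (b i)) q) p =
      ∑ j, dirDeriv (e i) (dirDeriv (e j) (dirDeriv (e j) (b i))) p := fun i =>
    dirDeriv_sum _ fun j => h₁ i _ _ p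
  have hr : ∀ j, dirDeriv (e j) (dirDeriv (e j) (fun q => ∑ i, dirDeriv (e i) (b i) q)) p =
      ∑ i, dirDeriv (e j) (dirDeriv (e j) (dirDeriv (e i) (b i))) p := by
    intro j
    have hj : dirDeriv (e j) (fun q => ∑ i, dirDeriv (e i) (b i) q) =
        fun q => ∑ i, dirDeriv (e j) (dirDeriv (e i) (b i)) q := funext fun q =>
      dirDeriv_sum _ fun i => (h₂ i _).differentiable (by norm_num) q
    rw [hj, dirDeriv_sum _ fun i => h₁ i _ _ p]
  simp only [hl, hr]
  rw [Finset.sum_comm]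
  refine Finset.sum_congr rfl fun j _ => Finset.sum_congr rfl fun i _ => ?_
  rw [dirDeriv_comm (h₂ i (e j)),
    funext (dirDeriv_comm ((hb i).of_le (by norm_num)) (e i) (e j))]

/-- The wave equation in terms of derivatives in constant directions. -/
theorem dirDeriv_wave_equation {b w : Fin 3 → E → ℝ} {f : E → ℝ} {e : Fin 3 → E} {t p : E}
    {c : ℝ} (hc : c ≠ 0) (hb : ∀ i, ContDiff ℝ 3 (b i)) (hw : ∀ i, ContDiff ℝ 2 (w i))
    (hf : ContDiff ℝ 2 f)
    (hind : ∀ i, (fun q => dirDeriv t (b i) q + c * dirDeriv (e i) f q) =ᶠ[nhds p] fun q =>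
      c * ∑ j, dirDeriv (e j) (dirDeriv (e j) (b i)) q -
        c * dirCurl e w i q)
    (hcon : (fun q => c * dirDeriv t f q + ∑ i, dirDeriv (e i) (b i) q) =ᶠ[nhds p] fun _ => 0) :
    dirDeriv t (dirDeriv t f) p - ∑ j, dirDeriv (e j) (dirDeriv (e j) f) p =
      -∑ j, dirDeriv (e j) (dirDeriv (e j) (fun q => ∑ i, dirDeriv (e i) (b i) q)) p := by
  have hfd : ∀ v, DifferentiableAt ℝ (dirDeriv v f) p := fun v =>
    (hf.dirDeriv (m := 1) v (by norm_num)).differentiable (by norm_num) p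
  have hb₂ : ∀ i v, ContDiff ℝ 2 (dirDeriv v (b i)) := fun i v =>
    (hb i).dirDeriv v (by norm_num)
  have hbd : ∀ i v, DifferentiableAt ℝ (dirDeriv v (b i)) p := fun i v =>
    (hb₂ i v).differentiable (by norm_num) p
  have hlap : ∀ i, DifferentiableAt ℝ
      (fun q => ∑ j, dirDeriv (e j) (dirDeriv (e j) (b i)) q) p := fun i =>
    DifferentiableAt.fun_sum fun j _ =>
      ((hb₂ i _).dirDeriv (m := 1) _ (by norm_num)).differentiable (by norm_num) p
  have htime := hcon.dirDeriv_eq t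
  rw [dirDeriv_add t ((hfd t).const_mul c) (DifferentiableAt.fun_sum fun i _ => hbd i _),
    dirDeriv_const_mul t c (hfd t), dirDeriv_sum t fun i => hbd i _] at htime
  have hdir : ∀ i, dirDeriv t (dirDeriv (e i) (b i)) p + c * dirDeriv (e i) (dirDeriv (e i) f) p =
      c * dirDeriv (e i) (fun q => ∑ j, dirDeriv (e j) (dirDeriv (e j) (b i)) q) p -
        c * dirDeriv (e i) (dirCurl e w i) p := by
    intro i
    have h := (hind i).dirDeriv_eq (e i)
    rw [dirDeriv_add _ (hbd i t) ((hfd _).const_mul c), dirDeriv_const_mul _ c (hfd _),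
      dirDeriv_sub _ ((hlap i).const_mul c) ((differentiable_dirCurl hw e i p).const_mul c),
      dirDeriv_const_mul _ c (hlap i), dirDeriv_const_mul _ c (differentiable_dirCurl hw e i p),
      dirDeriv_comm ((hb i).of_le (by norm_num))] at h
    exact h
  have hspace := Finset.sum_congr (rfl : (Finset.univ : Finset (Fin 3)) = _) fun i _ => hdir i
  simp only [Finset.sum_add_distrib, Finset.sum_sub_distrib, ← Finset.mul_sum] at hspace
  rw [dirDeriv_div_curl hw, dirDeriv_div_laplacian hb] at hspace
  have hzero : dirDeriv t (fun _ : E => (0 : ℝ)) p = 0 := by simp [dirDeriv]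
  apply mul_left_cancel₀ hc
  linear_combination htime + hzero - hspace

end DirectionalDerivative

theorem pd3_slice {g : (Fin 3 → ℝ) × ℝ → ℝ} {x : Fin 3 → ℝ} {τ : ℝ}
    (hg : DifferentiableAt ℝ g (x, τ)) (j : Fin 3) :
    pd3 (fun y => g (y, τ)) x j = dirDeriv (Pi.single j 1, 0) g (x, τ) := by
  have h := hg.hasFDerivAt.comp x (hasFDerivAt_prodMk_left (𝕜 := ℝ) x τ)
  simp only [pd3, dirDeriv]
  rw [show fderiv ℝ (fun y => g (y, τ)) x = _ from h.fderiv]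
  simp

theorem deriv_slice {g : (Fin 3 → ℝ) × ℝ → ℝ} {x : Fin 3 → ℝ} {τ : ℝ}
    (hg : DifferentiableAt ℝ g (x, τ)) :
    deriv (fun t => g (x, t)) τ = dirDeriv (0, 1) g (x, τ) := by
  have h := hg.hasFDerivAt.comp τ (hasFDerivAt_prodMk_right (𝕜 := ℝ) x τ)
  rw [← fderiv_apply_one_eq_deriv, show fderiv ℝ (fun t => g (x, t)) τ = _ from h.fderiv]
  simp [dirDeriv]

theorem lap3_slice {g : (Fin 3 → ℝ) × ℝ → ℝ} (hg : ContDiff ℝ 2 g) (x : Fin 3 → ℝ) (τ : ℝ) :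
    lap3 (fun y => g (y, τ)) x =
      ∑ j, dirDeriv (Pi.single j 1, 0) (dirDeriv (Pi.single j 1, 0) g) (x, τ) := by
  refine Finset.sum_congr rfl fun j _ => ?_
  simp only [pd3_slice (hg.differentiable (by norm_num) _)]
  exact pd3_slice ((hg.dirDeriv (m := 1) _ (by norm_num)).differentiable (by norm_num) _) j

theorem div3_slice {F : Fin 3 → (Fin 3 → ℝ) × ℝ → ℝ} (hF : ∀ i, Differentiable ℝ (F i))
    (x : Fin 3 → ℝ) (τ : ℝ) :
    div3 (fun y i => F i (y, τ)) x = ∑ i, dirDeriv (Pi.single i 1, 0) (F i) (x, τ) :=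
  Finset.sum_congr rfl fun i _ => pd3_slice (hF i _) i

theorem curl3_slice {F : Fin 3 → (Fin 3 → ℝ) × ℝ → ℝ} (hF : ∀ i, Differentiable ℝ (F i))
    (x : Fin 3 → ℝ) (τ : ℝ) (i : Fin 3) :
    curl3 (fun y k => F k (y, τ)) x i =
      dirCurl (fun j => (Pi.single j 1, 0)) F i (x, τ) := by
  simp only [curl3, pd3_slice (hF _ _)]
  fin_cases i <;> rfl

/-- The acoustic wave equation (4.4) for the rescaled scalar potential: if
`∂_τ B + √ε ∇φ = √ε Δ B − √ε curl(u × B)` and `√ε ∂_τ φ + div B = 0` hold pointwise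
on `ℝ³ × [0,T]`, then `∂_{ττ} φ − Δφ = −Δ(div B)` pointwise on `ℝ³ × (0,T)`. -/
theorem wave_equation_for_potential
    (ε T : ℝ) (hε : 0 < ε) (hT : 0 < T)
    (u B : (Fin 3 → ℝ) → ℝ → (Fin 3 → ℝ)) (φ : (Fin 3 → ℝ) → ℝ → ℝ)
    (hu_reg : ContDiff ℝ 3 fun q : (Fin 3 → ℝ) × ℝ => u q.1 q.2)
    (hB_reg : ContDiff ℝ 3 fun q : (Fin 3 → ℝ) × ℝ => B q.1 q.2)
    (hφ_reg : ContDiff ℝ 3 fun q : (Fin 3 → ℝ) × ℝ => φ q.1 q.2)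
    (hinduction : ∀ x : Fin 3 → ℝ, ∀ τ ∈ Set.Icc (0 : ℝ) T, ∀ i : Fin 3,
      deriv (fun t => B x t i) τ + Real.sqrt ε * pd3 (fun y => φ y τ) x i =
        Real.sqrt ε * lap3 (fun y => B y τ i) x -
          Real.sqrt ε * curl3 (fun y => crossProduct (u y τ) (B y τ)) x i)
    (hconstraint : ∀ x : Fin 3 → ℝ, ∀ τ ∈ Set.Icc (0 : ℝ) T,
      Real.sqrt ε * deriv (fun t => φ x t) τ + div3 (fun y => B y τ) x = 0) :
    ∀ x : Fin 3 → ℝ, ∀ τ ∈ Set.Ioo (0 : ℝ) T,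
      deriv (fun t => deriv (fun s => φ x s) t) τ - lap3 (fun y => φ y τ) x =
        -lap3 (fun y => div3 (fun z => B z τ) y) x := by
  intro x τ hτ
  have hb : ∀ i, ContDiff ℝ 3 fun q : (Fin 3 → ℝ) × ℝ => B q.1 q.2 i := contDiff_pi.1 hB_reg
  have hv : ∀ i, ContDiff ℝ 3 fun q : (Fin 3 → ℝ) × ℝ => u q.1 q.2 i := contDiff_pi.1 hu_reg
  have hw : ∀ i, ContDiff ℝ 2
      fun q : (Fin 3 → ℝ) × ℝ => crossProduct (u q.1 q.2) (B q.1 q.2) i := by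
    intro i
    simp only [cross_apply]
    fin_cases i <;>
      exact (((hv _).mul (hb _)).sub ((hv _).mul (hb _))).of_le (by norm_num)
  have hφ : ContDiff ℝ 2 fun q : (Fin 3 → ℝ) × ℝ => φ q.1 q.2 := hφ_reg.of_le (by norm_num)
  have hbd i := (hb i).differentiable (by norm_num)
  have hwd i := (hw i).differentiable (by norm_num)
  have hφd := hφ.differentiable (by norm_num)
  have hdiv : ContDiff ℝ 2 fun q : (Fin 3 → ℝ) × ℝ =>
      ∑ i, dirDeriv (Pi.single i 1, 0) (fun q : (Fin 3 → ℝ) × ℝ => B q.1 q.2 i) q :=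
    ContDiff.sum fun i _ => (hb i).dirDeriv _ (by norm_num)
  have hnear : ∀ᶠ q : (Fin 3 → ℝ) × ℝ in nhds (x, τ), q.2 ∈ Set.Icc 0 T :=
    continuous_snd.continuousAt.eventually (Icc_mem_nhds hτ.1 hτ.2)
  have hdivB : ∀ y s, div3 (fun z => B z s) y =
      ∑ i, dirDeriv (Pi.single i 1, 0) (fun q : (Fin 3 → ℝ) × ℝ => B q.1 q.2 i) (y, s) :=
    div3_slice hbd
  have hderiv : ∀ y s, deriv (fun t => φ y t) s =
      dirDeriv (0, 1) (fun q : (Fin 3 → ℝ) × ℝ => φ q.1 q.2) (y, s) :=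
    fun y s => deriv_slice (hφd (y, s))
  have hwave := dirDeriv_wave_equation (t := ((0, 1) : (Fin 3 → ℝ) × ℝ)) (p := (x, τ))
    (e := fun i => (Pi.single i 1, 0)) (Real.sqrt_pos.2 hε).ne' hb hw hφ ?_ ?_
  · simp only [hderiv, hdivB]
    rw [lap3_slice hdiv, lap3_slice hφ,
      deriv_slice ((hφ.dirDeriv (m := 1) _ (by norm_num)).differentiable (by norm_num) _)]
    exact hwave
  · intro i
    filter_upwards [hnear] with q hq
    have h := hinduction q.1 q.2 hq i
    rw [deriv_slice (hbd i q), pd3_slice (hφd q), lap3_slice ((hb i).of_le (by norm_num))] at h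
    exact h.trans (congrArg _ (congrArg _ (curl3_slice hwd q.1 q.2 i)))
  · filter_upwards [hnear] with q hq
    have h := hconstraint q.1 q.2 hq
    rwa [hderiv, hdivB] at h
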